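/- For every infinite cardinal κ, the supremum of the dichromatic numbers χ(D) over all orientations D of the complete graph K_κ equals κ; that is, every orientation of K_κ has dichromatic number at most κ, and for every cardinal μ < κ there is an orientation D of K_κ with χ(D) > μ. -/

import Mathlib

/-- A digraph on a vertex set `verts`: arcs go between vertices of `verts`,
there are no loops and no pair of opposite arcs. -/
structure Digraph' (V : Type*) where
  verts : Set V
  Arc : V → V → Prop
  arc_left : ∀ ⦃u v : V⦄, Arc u v → u ∈ verts
  arc_right : ∀ ⦃u v : V⦄, Arc u v → v ∈ verts
  irrefl' : ∀ v : V, ¬ Arc v v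
  asymm' : ∀ u v : V, Arc u v → ¬ Arc v u

namespace Digraph'

variable {V : Type*} {W : Type*}

/-- A directed cycle of length `m` (with `m ≥ 1`) with respect to the arc relation `E`,
all of whose vertices lie in `A`. -/
def RelDicycle (E : V → V → Prop) (A : Set V) (m : ℕ) (c : ZMod m → V) : Prop :=
  1 ≤ m ∧ Function.Injective c ∧ (∀ i, c i ∈ A) ∧ ∀ i, E (c i) (c (i + 1))

/-- The arc relation `E` has no directed cycle of length `≤ k`, i.e. digirth `> k`. -/
def RelDigirthGT (E : V → V → Prop) (k : ℕ) : Prop :=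
  ∀ m ≤ k, ∀ c : ZMod m → V, ¬ RelDicycle E Set.univ m c

/-- A directed cycle of length `m` in the digraph `D`, all of whose vertices lie in `A`. -/
def DicycleIn (D : Digraph' V) (A : Set V) (m : ℕ) (c : ZMod m → V) : Prop :=
  RelDicycle D.Arc A m c

/-- The digraph `D` has digirth `> k`. -/
def DigirthGT (D : Digraph' V) (k : ℕ) : Prop :=
  RelDigirthGT D.Arc k

/-- `A` is an acyclic set of vertices of `D`: the subdigraph induced on `A`
contains no directed cycle. -/
def AcyclicSet (D : Digraph' V) (A : Set V) : Prop :=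
  ∀ m c, ¬ D.DicycleIn A m c

/-- `D` has uncountable dichromatic number: its vertex set cannot be covered by
countably many acyclic sets. -/
def UncountableDichromatic (D : Digraph' V) : Prop :=
  ¬ ∃ F : ℕ → Set V, (∀ n, D.AcyclicSet (F n)) ∧ D.verts ⊆ ⋃ n, F n

/-- The dichromatic number of `D` is at most `μ`: the vertex set can be covered by
at most `μ` many acyclic sets. -/
def DichromaticLE (D : Digraph' V) (μ : Cardinal) : Prop :=
  ∃ 𝒜 : Set (Set V), Cardinal.mk 𝒜 ≤ μ ∧ (∀ A ∈ 𝒜, D.AcyclicSet A) ∧ D.verts ⊆ ⋃₀ 𝒜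

/-- The subdigraph of `D` induced on the set `A`. -/
def induce (D : Digraph' V) (A : Set V) : Digraph' V where
  verts := D.verts ∩ A
  Arc u v := D.Arc u v ∧ u ∈ A ∧ v ∈ A
  arc_left := fun _ _ h => ⟨D.arc_left h.1, h.2.1⟩
  arc_right := fun _ _ h => ⟨D.arc_right h.1, h.2.2⟩
  irrefl' := fun v h => D.irrefl' v h.1
  asymm' := fun u v h h' => D.asymm' u v h.1 h'.1

/-- `D₀` embeds into `D`: an injective map of the vertices carrying arcs to arcs
(the copy need not be induced). -/
def Embeds (D₀ : Digraph' W) (D : Digraph' V) : Prop :=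
  ∃ f : W → V, Set.InjOn f D₀.verts ∧ Set.MapsTo f D₀.verts D.verts ∧
    ∀ ⦃u v : W⦄, D₀.Arc u v → D.Arc (f u) (f v)

/-- The reverse of a digraph: all arcs are reversed. -/
def rev (D : Digraph' V) : Digraph' V where
  verts := D.verts
  Arc u v := D.Arc v u
  arc_left := fun _ _ h => D.arc_right h
  arc_right := fun _ _ h => D.arc_left h
  irrefl' := fun v h => D.irrefl' v h
  asymm' := fun u v h h' => D.asymm' v u h h'

end Digraph'

/-- `D` is an orientation of the complete graph on its (full) vertex type. -/
def IsCompleteOrientation {V : Type*} (D : Digraph' V) : Prop :=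
  D.verts = Set.univ ∧ ∀ u v : V, u ≠ v → (D.Arc u v ∨ D.Arc v u)

/-- An asymmetric relation on pairs, for which every set that has unboundedly many unbounded
vertical sections contains a directed triangle. -/
def PairArc {W : Type*} [LT W] (p q : W × W) : Prop :=
  (p.1 < q.1 ∧ q.2 < p.2) ∨ (p.1 < q.1 ∧ p.2 < q.1) ∨
    (q.1 < p.1 ∧ p.1 < q.2 ∧ q.2 < p.2)

theorem PairArc.asymm {W : Type*} [LinearOrder W] {p q : W × W} (h : PairArc p q) :
    ¬ PairArc q p := by
  unfold PairArc at *
  grind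

/-- Unboundedly many unbounded vertical sections yield a directed triangle. -/
theorem PairArc.exists_triangle {W : Type*} [LinearOrder W] [Nonempty W] {S : Set (W × W)}
    (hS : ∀ a, ∃ x, a < x ∧ ∀ b, ∃ y, b < y ∧ (x, y) ∈ S) :
    ∃ p ∈ S, ∃ q ∈ S, ∃ r ∈ S, PairArc p q ∧ PairArc q r ∧ PairArc r p := by
  obtain ⟨x₁, -, h₁⟩ := hS (Classical.arbitrary W)
  obtain ⟨x₂, hx₂, h₂⟩ := hS x₁
  obtain ⟨y₂, hy₂, m₂⟩ := h₂ x₂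
  obtain ⟨x₃, hx₃, h₃⟩ := hS y₂
  obtain ⟨y₁, hy₁, m₁⟩ := h₁ x₃
  obtain ⟨y₃, hy₃, m₃⟩ := h₃ y₁
  refine ⟨_, m₁, _, m₂, _, m₃, ?_, ?_, ?_⟩ <;> unfold PairArc <;> grind

/-- A colouring of a regular cardinal with fewer colours has an unbounded colour class. -/
theorem exists_unbounded_fiber.{u} {c : Cardinal.{u}} (hc : c.IsRegular) {ι : Type u}
    (hι : Cardinal.mk ι < c) (f : c.ord.ToType → ι) :
    ∃ i, ∀ a, ∃ x, a < x ∧ f x = i := by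
  obtain ⟨i, hi⟩ := Cardinal.infinite_pigeonhole_card f c (by simp) hc.aleph0_le
    (by rwa [hc.cof_ord])
  refine ⟨i, fun a => ?_⟩
  by_contra! h
  have hsub : f ⁻¹' {i} ⊆ Set.Iic a := fun x hx => not_lt.1 fun hlt => h x hlt hx
  have hlt : Cardinal.mk (Set.Iic a) < c := by
    have hIio : Cardinal.mk (Set.Iio a) < c := by
      simpa using Cardinal.mk_Iio_lt a (by simp)
    rw [← Set.Iio_insert]
    exact Cardinal.mk_insert_le.trans_lt
      (Cardinal.add_lt_of_lt hc.aleph0_le hIio (Cardinal.one_lt_aleph0.trans_le hc.aleph0_le))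
  exact absurd (hi.trans (Cardinal.mk_le_mk_of_subset hsub)) hlt.not_ge

namespace Digraph'

/-- The complete orientation extending the pullback of `PairArc` along `h`. -/
noncomputable def ofPairs {V W : Type*} [LinearOrder V] [LinearOrder W] (h : V → W × W) :
    Digraph' V where
  verts := Set.univ
  Arc u v := PairArc (h u) (h v) ∨ (¬ PairArc (h v) (h u) ∧ u < v)
  arc_left _ _ _ := Set.mem_univ _
  arc_right _ _ _ := Set.mem_univ _
  irrefl' v hv := hv.elim (fun hv => hv.asymm hv) fun hv => lt_irrefl v hv.2
  asymm' u v := by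
    have := @PairArc.asymm W _ (h u) (h v)
    grind

theorem isCompleteOrientation_ofPairs {V W : Type*} [LinearOrder V] [LinearOrder W]
    (h : V → W × W) : IsCompleteOrientation (ofPairs h) := by
  refine ⟨rfl, fun u v huv => ?_⟩
  have := lt_or_gt_of_ne huv
  simp only [ofPairs]
  grind

theorem acyclicSet_singleton {V : Type*} (D : Digraph' V) (v : V) : D.AcyclicSet {v} := by
  rintro m c ⟨-, -, hv, harc⟩
  have h := harc 0
  rw [hv 0, hv (0 + 1)] at h
  exact D.irrefl' v h

theorem AcyclicSet.not_triangle {V : Type*} {D : Digraph' V} {A : Set V} (hA : D.AcyclicSet A)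
    {u v w : V} (hu : u ∈ A) (hv : v ∈ A) (hw : w ∈ A)
    (huv : D.Arc u v) (hvw : D.Arc v w) : ¬ D.Arc w u := by
  intro hwu
  have huv' : u ≠ v := by rintro rfl; exact D.irrefl' _ huv
  have hvw' : v ≠ w := by rintro rfl; exact D.irrefl' _ hvw
  have hwu' : w ≠ u := by rintro rfl; exact D.irrefl' _ hwu
  refine hA 3 (![u, v, w] : Fin 3 → V) ⟨by norm_num, ?_, ?_, ?_⟩
  · change Function.Injective (![u, v, w] : Fin 3 → V)
    intro i j
    fin_cases i <;> fin_cases j <;> simp [huv', hvw', hwu', huv'.symm, hvw'.symm, hwu'.symm]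
  · change ∀ i : Fin 3, (![u, v, w] : Fin 3 → V) i ∈ A
    intro i
    fin_cases i <;> simpa
  · change ∀ i : Fin 3, D.Arc ((![u, v, w] : Fin 3 → V) i) ((![u, v, w] : Fin 3 → V) (i + 1))
    intro i
    fin_cases i <;> simpa

theorem dichromaticLE_mk {V : Type*} (D : Digraph' V) : D.DichromaticLE (Cardinal.mk V) := by
  refine ⟨Set.range fun v => {v}, Cardinal.mk_range_le, ?_, fun v _ => ⟨{v}, ⟨v, rfl⟩, rfl⟩⟩
  rintro _ ⟨v, rfl⟩
  exact D.acyclicSet_singleton v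

theorem not_dichromaticLE_ofPairs.{u} {c μ : Cardinal.{u}} (hc : c.IsRegular) (hμ : μ < c)
    {V : Type u} [LinearOrder V] {h : V → c.ord.ToType × c.ord.ToType}
    (hh : Function.Surjective h) : ¬ (ofPairs h).DichromaticLE μ := by
  rintro ⟨𝒜, h𝒜, hacyc, hcov⟩
  obtain ⟨g, hg⟩ := hh.hasRightInverse
  have hmem : ∀ p, ∃ A : 𝒜, g p ∈ A.1 := fun p =>
    let ⟨A, hA, hp⟩ := hcov (Set.mem_univ (g p)); ⟨⟨A, hA⟩, hp⟩
  choose col hcol using hmem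
  have hlt : Cardinal.mk 𝒜 < c := h𝒜.trans_lt hμ
  choose row hrow using fun x => exists_unbounded_fiber hc hlt fun y => col (x, y)
  obtain ⟨A, hA⟩ := exists_unbounded_fiber hc hlt row
  have : Nonempty c.ord.ToType := by
    rw [← Cardinal.mk_ne_zero_iff, Cardinal.mk_ord_toType]
    exact hc.pos.ne'
  obtain ⟨p, hp, q, hq, r, hr, hpq, hqr, hrp⟩ :=
    PairArc.exists_triangle (S := {p | col p = A}) fun a =>
      let ⟨x, hax, hx⟩ := hA a
      ⟨x, hax, fun b => let ⟨y, hby, hy⟩ := hrow x b; ⟨y, hby, hy.trans hx⟩⟩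
  have key : ∀ s, col s = A → g s ∈ A.1 := fun s hs => hs ▸ hcol s
  have arc : ∀ s t, PairArc s t → (ofPairs h).Arc (g s) (g t) := fun s t hst =>
    Or.inl (by rwa [hg s, hg t])
  exact (hacyc A.1 A.2).not_triangle (key p hp) (key q hq) (key r hr)
    (arc p q hpq) (arc q r hqr) (arc r p hrp)

end Digraph'

/-- For every infinite cardinal `κ`, the supremum of the dichromatic numbers of the
orientations of `K_κ` equals `κ`: every orientation has dichromatic number at most `κ`,
and for every `μ < κ` some orientation has dichromatic number greater than `μ`. -/
theorem statement_10.{u} (κ : Cardinal.{u}) (hκ : Cardinal.aleph0 ≤ κ)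
    (α : Type u) (hα : Cardinal.mk α = κ) :
    (∀ D : Digraph' α, IsCompleteOrientation D → D.DichromaticLE κ) ∧
    (∀ μ : Cardinal.{u}, μ < κ →
      ∃ D : Digraph' α, IsCompleteOrientation D ∧ ¬ D.DichromaticLE μ) := by
  subst hα
  refine ⟨fun D _ => D.dichromaticLE_mk, fun μ hμ => ?_⟩
  obtain ⟨c, hc, hμc, hcα⟩ : ∃ c : Cardinal.{u}, c.IsRegular ∧ μ < c ∧ c ≤ Cardinal.mk α := by
    rcases lt_or_ge μ Cardinal.aleph0 with h | h
    · exact ⟨_, Cardinal.isRegular_aleph0, h, hκ⟩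
    · exact ⟨_, Cardinal.isRegular_succ h, Order.lt_succ μ, Order.succ_le_of_lt hμ⟩
  have hcard : Cardinal.mk (c.ord.ToType × c.ord.ToType) ≤ Cardinal.mk α := by
    simpa [Cardinal.mul_eq_self hc.aleph0_le] using hcα
  have hne : Nonempty (c.ord.ToType × c.ord.ToType) := by
    rw [← Cardinal.mk_ne_zero_iff]
    simpa using hc.pos.ne'
  obtain ⟨g⟩ := hcard
  classical
  let : LinearOrder α := linearOrderOfSTO WellOrderingRel
  exact ⟨_, Digraph'.isCompleteOrientation_ofPairs _,
    Digraph'.not_dichromaticLE_ofPairs hc hμc (Function.invFun_surjective g.injective)⟩
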